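/- Let e be a symmetric distance on X (e(x,y) = e(y,x) for all x,y). Suppose X is e-complete, e∘Φ^d ⪅ d, and d ⪅ e. Then for every d-Cauchy net (x_λ) in X there is a d-directed set Y ⊆ X such that sup_{y∈Y} d(y,z) = lim_λ d(x_λ,z) and inf_{y∈Y} d(z,y) = lim_λ d(z,x_λ) for all z ∈ X. -/

import Mathlib

open scoped ENNReal

universe u v

/-- liminf of a `[0,∞]`-valued net indexed by a set with relation `r`. -/
noncomputable def netLiminf {ι : Type v} (r : ι → ι → Prop) (f : ι → ℝ≥0∞) : ℝ≥0∞ :=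
  ⨆ γ : ι, ⨅ l : ι, ⨅ _ : r γ l, f l

/-- limsup of a `[0,∞]`-valued net indexed by a set with relation `r`. -/
noncomputable def netLimsup {ι : Type v} (r : ι → ι → Prop) (f : ι → ℝ≥0∞) : ℝ≥0∞ :=
  ⨅ γ : ι, ⨆ l : ι, ⨆ _ : r γ l, f l

/-- `lim f = L` : both liminf and limsup equal `L`. -/
def NetLimEq {ι : Type v} (r : ι → ι → Prop) (f : ι → ℝ≥0∞) (L : ℝ≥0∞) : Prop :=
  netLiminf r f = L ∧ netLimsup r f = L

/-- `d` satisfies the triangle inequality. -/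
def IsDistance {X : Type u} (d : X → X → ℝ≥0∞) : Prop :=
  ∀ x y z, d x z ≤ d x y + d y z

/-- the index relation is transitive and directed. -/
def DirectedIndex {ι : Type v} (r : ι → ι → Prop) : Prop :=
  (∀ a b c : ι, r a b → r b c → r a c) ∧ (∀ a b : ι, ∃ c, r a c ∧ r b c)

/-- `d`-Cauchy net. -/
def IsCauchyNet {X : Type u} {ι : Type v} (d : X → X → ℝ≥0∞) (r : ι → ι → Prop)
    (x : ι → X) : Prop :=
  ∀ ε : ℝ≥0∞, 0 < ε → ∃ α, ∀ γ δ, r α γ → r γ δ → d (x γ) (x δ) < ε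

/-- `d`-pre-Cauchy net. -/
def IsPreCauchyNet {X : Type u} {ι : Type v} (d : X → X → ℝ≥0∞) (r : ι → ι → Prop)
    (x : ι → X) : Prop :=
  ∀ ε : ℝ≥0∞, 0 < ε → ∃ α, ∀ γ, r α γ → ∃ β, ∀ δ, r β δ → d (x γ) (x δ) < ε

/-- `d`-reflexive net. -/
def IsReflexiveNet {X : Type u} {ι : Type v} (d : X → X → ℝ≥0∞) (r : ι → ι → Prop)
    (x : ι → X) : Prop :=
  ∀ ε : ℝ≥0∞, 0 < ε → ∃ α, ∀ γ, r α γ → ∀ β, ∃ δ, r β δ ∧ d (x γ) (x δ) < ε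

/-- `x` is a `d`-supremum of `Y`. -/
def IsDSup {X : Type u} (d : X → X → ℝ≥0∞) (Y : Set X) (x : X) : Prop :=
  (∀ y ∈ Y, d y x = 0) ∧ ∀ z, d x z = ⨆ y ∈ Y, d y z

/-- `x` is a `≤ᵈ`-supremum of `Y`. -/
def IsLeDSup {X : Type u} (d : X → X → ℝ≥0∞) (Y : Set X) (x : X) : Prop :=
  (∀ y ∈ Y, d y x = 0) ∧ ∀ z, (∀ y ∈ Y, d y z = 0) → d x z = 0

/-- `Y` is `d`-directed. -/
def DDirected {X : Type u} (d : X → X → ℝ≥0∞) (Y : Set X) : Prop :=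
  ∀ F : Finset X, ↑F ⊆ Y → ∀ ε : ℝ≥0∞, 0 < ε → ∃ y ∈ Y, ∀ z ∈ F, d z y < ε

/-- `Y` is `≤ᵈ`-directed (directed sets are nonempty). -/
def LeDDirected {X : Type u} (d : X → X → ℝ≥0∞) (Y : Set X) : Prop :=
  Y.Nonempty ∧ ∀ y₁ ∈ Y, ∀ y₂ ∈ Y, ∃ y ∈ Y, d y₁ y = 0 ∧ d y₂ y = 0

/-- `X` is `f`-complete: every `f`-Cauchy net has an `X°°`-limit w.r.t. `f`. -/
def IsYonedaComplete {X : Type u} (f : X → X → ℝ≥0∞) : Prop :=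
  ∀ (ι : Type u) (r : ι → ι → Prop) (x : ι → X), Nonempty ι → DirectedIndex r →
    IsCauchyNet f r x →
    ∃ z : X, (∀ c, f z c ≤ netLiminf r fun l => f (x l) c) ∧
             (∀ c, f c z ≤ netLiminf r fun l => f c (x l))

/-- `d^•(s) = sup_x inf { d(x,y) : y ≤ᵈ x^•_s }`. -/
noncomputable def dBulletUpper {X : Type u} (d : X → X → ℝ≥0∞) (s : ℝ≥0∞) : ℝ≥0∞ :=
  ⨆ x : X, ⨅ y : X, ⨅ _ : ∀ z, d x z < s → d y z = 0, d x y

/-- `d_•(s) = sup_x inf { d(y,x) : x^s_• ≤ᵈ y }`. -/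
noncomputable def dBulletLower {X : Type u} (d : X → X → ℝ≥0∞) (s : ℝ≥0∞) : ℝ≥0∞ :=
  ⨆ x : X, ⨅ y : X, ⨅ _ : ∀ z, d z x < s → d z y = 0, d y x

/-- `d_F(s)`. -/
noncomputable def dFin {X : Type u} (d : X → X → ℝ≥0∞) (s : ℝ≥0∞) : ℝ≥0∞ :=
  ⨆ x : X, ⨆ F : Finset X, ⨆ _ : ∀ z ∈ F, d z x < s,
    ⨅ y : X, ⨅ _ : ∀ z ∈ F, d z y = 0, d y x

/-- `d_Φ(s)`. -/
noncomputable def dPhi {X : Type u} (d : X → X → ℝ≥0∞) (s : ℝ≥0∞) : ℝ≥0∞ :=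
  ⨆ x : X, ⨆ F : Finset X, ⨆ _ : ∀ z ∈ F, d z x < s, ⨆ ε : ℝ≥0∞, ⨆ _ : 0 < ε,
    ⨅ y : X, ⨅ _ : ∀ z ∈ F, d z y < ε, d y x

/-- `e∘Φᵈ(x,y) = sup_{ε>0} inf { e(x,z) : d(z,y) < ε }`. -/
noncomputable def ePhiD {X : Type u} (e d : X → X → ℝ≥0∞) (x y : X) : ℝ≥0∞ :=
  ⨆ ε : ℝ≥0∞, ⨆ _ : 0 < ε, ⨅ z : X, ⨅ _ : d z y < ε, e x z

/-- `f ⪅ g` : uniform subequivalence. -/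
def SubEquiv {X : Type u} (f g : X → X → ℝ≥0∞) : Prop :=
  ∀ ε : ℝ≥0∞, 0 < ε → ∃ δ : ℝ≥0∞, 0 < δ ∧ ∀ x y, g x y ≤ δ → f x y ≤ ε

theorem SubEquiv.exists_approx {X : Type u} {e d : X → X → ℝ≥0∞} (h : SubEquiv (ePhiD e d) d)
    {ε : ℝ≥0∞} (hε : 0 < ε) :
    ∃ δ : ℝ≥0∞, 0 < δ ∧ ∀ x y, d x y ≤ δ → ∀ η, 0 < η → ∃ z, d z y < η ∧ e x z < ε := by
  obtain ⟨ε', hε'0, hε'⟩ := exists_between hε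
  obtain ⟨δ, hδ, H⟩ := h ε' hε'0
  refine ⟨δ, hδ, fun x y hxy η hη => ?_⟩
  have hlt : (⨅ z : X, ⨅ _ : d z y < η, e x z) < ε :=
    ((le_iSup₂ (f := fun η (_ : 0 < η) => ⨅ z : X, ⨅ _ : d z y < η, e x z) η hη).trans
      (H x y hxy)).trans_lt hε'
  simp only [iInf_lt_iff] at hlt
  obtain ⟨z, hz, hxz⟩ := hlt
  exact ⟨z, hz, hxz⟩

theorem netLiminf_le {ι : Type v} {r : ι → ι → Prop} {f : ι → ℝ≥0∞} {C : ℝ≥0∞}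
    (h : ∀ γ, ∃ l, r γ l ∧ f l ≤ C) : netLiminf r f ≤ C := by
  refine iSup_le fun γ => ?_
  obtain ⟨l, hl, hf⟩ := h γ
  exact (iInf₂_le l hl).trans hf

theorem le_netLiminf {ι : Type v} {r : ι → ι → Prop} {f : ι → ℝ≥0∞} {C : ℝ≥0∞} (γ : ι)
    (h : ∀ l, r γ l → C ≤ f l) : C ≤ netLiminf r f :=
  (le_iInf₂ h).trans (le_iSup (fun γ : ι => ⨅ l : ι, ⨅ _ : r γ l, f l) γ)

theorem netLimsup_le {ι : Type v} {r : ι → ι → Prop} {f : ι → ℝ≥0∞} {C : ℝ≥0∞} (γ : ι)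
    (h : ∀ l, r γ l → f l ≤ C) : netLimsup r f ≤ C :=
  (iInf_le (fun γ : ι => ⨆ l : ι, ⨆ _ : r γ l, f l) γ).trans (iSup₂_le h)

theorem netLiminf_le_netLimsup {ι : Type v} {r : ι → ι → Prop} (hr : DirectedIndex r)
    (f : ι → ℝ≥0∞) : netLiminf r f ≤ netLimsup r f := by
  refine iSup_le fun γ => le_iInf fun γ' => ?_
  obtain ⟨l, hl, hl'⟩ := hr.2 γ γ'
  exact (iInf₂_le l hl).trans (le_iSup₂ (f := fun l (_ : r γ' l) => f l) l hl')

theorem NetLimEq.of_le {ι : Type v} {r : ι → ι → Prop} (hr : DirectedIndex r)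
    {f : ι → ℝ≥0∞} {L : ℝ≥0∞} (h₁ : L ≤ netLiminf r f) (h₂ : netLimsup r f ≤ L) :
    NetLimEq r f L :=
  ⟨((netLiminf_le_netLimsup hr f).trans h₂).antisymm h₁,
    h₂.antisymm (h₁.trans (netLiminf_le_netLimsup hr f))⟩

theorem DirectedIndex.exists_seq {ι : Type v} {r : ι → ι → Prop} (hr : DirectedIndex r)
    (γ : ι) (α : ℕ → ι) :
    ∃ l : ℕ → ι, r γ (l 0) ∧ ∀ n, r (α n) (l n) ∧ r (l n) (l (n + 1)) := by
  choose u hu₁ hu₂ using hr.2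
  let l : ℕ → ι := fun n => Nat.rec (u γ (α 0)) (fun n a => u a (α (n + 1))) n
  refine ⟨l, hu₁ _ _, fun n => ⟨?_, hu₁ _ _⟩⟩
  cases n <;> exact hu₂ _ _

/-- A sequence with geometrically decreasing steps has a limit at geometric distance. -/
theorem IsYonedaComplete.exists_limit_of_geometric {X : Type u} {e : X → X → ℝ≥0∞}
    (hcomp : IsYonedaComplete e) (he : IsDistance e) {a : ℕ → ℝ≥0∞}
    (ha : Filter.Tendsto a Filter.atTop (nhds 0)) (hadd : ∀ n, a (n + 1) + a (n + 1) = a n)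
    {y : ℕ → X} (hy : ∀ n, e (y n) (y (n + 1)) ≤ a (n + 1)) :
    ∃ z, ∀ n, e (y n) z ≤ a n := by
  have step : ∀ k n, e (y n) (y (n + k + 1)) ≤ a n := by
    intro k
    induction k with
    | zero => exact fun n => (hy n).trans ((hadd n).symm ▸ le_self_add)
    | succ k ih =>
      intro n
      have h := ih (n + 1)
      rw [show n + 1 + k + 1 = n + (k + 1) + 1 by omega] at h
      exact (he _ _ _).trans ((add_le_add (hy n) h).trans (hadd n).le)
  have step' : ∀ n m, n < m → e (y n) (y m) ≤ a n := by
    intro n m hnm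
    obtain ⟨k, rfl⟩ := Nat.exists_eq_add_of_lt hnm
    exact step k n
  obtain ⟨z, -, hz⟩ := hcomp (ULift.{u} ℕ) (fun i j => i.down < j.down) (fun i => y i.down)
    ⟨⟨0⟩⟩ ⟨fun _ _ _ => lt_trans, fun i j =>
      ⟨⟨i.down + j.down + 1⟩, by dsimp; omega, by dsimp; omega⟩⟩
    (by
      intro ε hε
      obtain ⟨N, hN⟩ := Filter.eventually_atTop.1 (ha.eventually_lt_const hε)
      exact ⟨⟨N⟩, fun i j hi hj => (step' _ _ hj).trans_lt (hN _ (le_of_lt hi))⟩)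
  refine ⟨z, fun n => (hz (y n)).trans (netLiminf_le fun γ => ?_)⟩
  exact ⟨⟨γ.down + n + 1⟩, by dsimp; omega, step' _ _ (by dsimp; omega)⟩

/-- The points `y` with `lim d(y, x_λ) = 0` come `e`-close to every late term of the net. -/
theorem exists_close_lower_point {X : Type u} {ι : Type v}
    {d e : X → X → ℝ≥0∞} (hd : IsDistance d) (he : IsDistance e)
    (hsym : ∀ x y : X, e x y = e y x) (hcomp : IsYonedaComplete e)
    (h1 : SubEquiv (ePhiD e d) d) (h2 : SubEquiv d e)
    {r : ι → ι → Prop} (hr : DirectedIndex r)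
    {x : ι → X} (hx : IsCauchyNet d r x) {ε : ℝ≥0∞} (hε : 0 < ε) :
    ∃ α, ∀ γ, r α γ → ∃ y,
      (∀ η : ℝ≥0∞, 0 < η → ∃ β, ∀ l, r β l → d y (x l) ≤ η) ∧ e (x γ) y ≤ ε := by
  obtain ⟨c, hc0, hcε, hctop⟩ : ∃ c : ℝ≥0∞, 0 < c ∧ c + c ≤ ε ∧ c ≠ ⊤ := by
    refine ⟨min ε 1 / 2, ENNReal.half_pos (by simp [hε.ne']), ?_, ?_⟩
    · rw [ENNReal.add_halves]; exact min_le_left _ _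
    · exact (ENNReal.div_lt_top (by simp) (by simp)).ne
  let a : ℕ → ℝ≥0∞ := fun n => c * 2⁻¹ ^ n
  have ha0 : ∀ n, 0 < a n := fun n =>
    ENNReal.mul_pos hc0.ne' (pow_ne_zero _ (by simp))
  have ha : Filter.Tendsto a Filter.atTop (nhds 0) := by
    have h := ENNReal.Tendsto.const_mul
      (ENNReal.tendsto_pow_atTop_nhds_zero_of_lt_one (r := 2⁻¹) (by simp))
      (Or.inr hctop : (0 : ℝ≥0∞) ≠ 0 ∨ c ≠ ⊤)
    simpa using h
  have hadd : ∀ n, a (n + 1) + a (n + 1) = a n := fun n => by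
    simp only [a, pow_succ]
    rw [← mul_add, ← mul_add, ENNReal.inv_two_add_inv_two, mul_one]
  obtain ⟨δ', hδ'0, hδ'⟩ := h1.exists_approx hc0
  choose δ hδ0 hδ using fun n => h1.exists_approx (ha0 (n + 1))
  let η : ℕ → ℝ≥0∞ := fun n => min (δ n / 2) (a n)
  have hη0 : ∀ n, 0 < η n := fun n => lt_min (ENNReal.half_pos (hδ0 n).ne') (ha0 n)
  have hηδ : ∀ n, η n + η n ≤ δ n := fun n =>
    (add_le_add (min_le_left _ _) (min_le_left _ _)).trans (ENNReal.add_halves _).le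
  obtain ⟨α, hα⟩ := hx δ' hδ'0
  choose β hβ using fun n => hx (η n) (hη0 n)
  refine ⟨α, fun γ hγ => ?_⟩
  obtain ⟨l, hl0, hl⟩ := hr.exists_seq γ β
  obtain ⟨y₀, hy₀d, hy₀e⟩ := hδ' _ _ (hα γ (l 0) hγ hl0).le (η 0) (hη0 0)
  have next : ∀ n z, ∃ z', d z (x (l n)) < η n →
      d z' (x (l (n + 1))) < η (n + 1) ∧ e z z' < a (n + 1) := by
    intro n z
    by_cases hz : d z (x (l n)) < η n
    · obtain ⟨z', hz'⟩ := hδ n z (x (l (n + 1)))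
        ((hd _ _ _).trans ((add_le_add hz.le (hβ n _ _ (hl n).1 (hl n).2).le).trans (hηδ n)))
        (η (n + 1)) (hη0 _)
      exact ⟨z', fun _ => hz'⟩
    · exact ⟨z, fun h => absurd h hz⟩
  choose g hg using next
  let y : ℕ → X := fun n => Nat.rec y₀ g n
  have hyd : ∀ n, d (y n) (x (l n)) < η n := by
    intro n
    induction n with
    | zero => exact hy₀d
    | succ n ih => exact (hg n (y n) ih).1
  obtain ⟨z, hz⟩ := hcomp.exists_limit_of_geometric he ha hadd
    (fun n => (hg n (y n) (hyd n)).2.le)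
  refine ⟨z, fun ε' hε' => ?_, ?_⟩
  · have h3 : 0 < ε' / 2 / 2 := ENNReal.half_pos (ENNReal.half_pos hε'.ne').ne'
    obtain ⟨θ, hθ0, hθ⟩ := h2 (ε' / 2) (ENNReal.half_pos hε'.ne')
    obtain ⟨n, hn1, hn2⟩ :=
      ((ha.eventually_lt_const hθ0).and (ha.eventually_lt_const h3)).exists
    refine ⟨l n, fun m hm => ?_⟩
    have hη : η n ≤ ε' / 2 / 2 := (min_le_right _ _).trans hn2.le
    calc d z (x m) ≤ d z (y n) + (d (y n) (x (l n)) + d (x (l n)) (x m)) :=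
          (hd _ _ _).trans (add_le_add le_rfl (hd _ _ _))
      _ ≤ ε' / 2 + (ε' / 2 / 2 + ε' / 2 / 2) := by
          gcongr
          · exact hθ _ _ (by rw [hsym]; exact (hz n).trans hn1.le)
          · exact (hyd n).le.trans hη
          · exact (hβ n _ _ (hl n).1 hm).le.trans hη
      _ = ε' := by rw [ENNReal.add_halves, ENNReal.add_halves]
  · have h0 : a 0 = c := by simp [a]
    exact (he _ (y 0) _).trans ((add_le_add hy₀e.le ((hz 0).trans h0.le)).trans hcε)

theorem DirectedIndex.exists_forall_finset {ι : Type v} {r : ι → ι → Prop}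
    (hr : DirectedIndex r) (hne : Nonempty ι) {X : Type u} (F : Finset X) (β : X → ι) :
    ∃ γ, ∀ z ∈ F, r (β z) γ := by
  classical
  induction F using Finset.induction_on with
  | empty => exact ⟨hne.some, by simp⟩
  | insert z F _ ih =>
    obtain ⟨γ, hγ⟩ := ih
    obtain ⟨γ', h₁, h₂⟩ := hr.2 γ (β z)
    refine ⟨γ', fun w hw => ?_⟩
    rcases Finset.mem_insert.1 hw with rfl | hw
    · exact h₂
    · exact hr.1 _ _ _ (hγ w hw) h₁

/-- If `e` is a symmetric distance, `X` is `e`-complete, `e∘Φᵈ ⪅ d` and `d ⪅ e`,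
then every d-Cauchy net admits a d-directed `Y` with `Yd = (x_λ)d` and `dY = d(x_λ)`. -/
theorem cauchy_to_dDirected {X : Type u} {ι : Type v}
    (d e : X → X → ℝ≥0∞) (hd : IsDistance d) (he : IsDistance e)
    (hsym : ∀ x y : X, e x y = e y x)
    (hcomp : IsYonedaComplete e)
    (h1 : SubEquiv (ePhiD e d) d) (h2 : SubEquiv d e)
    (r : ι → ι → Prop) (hne : Nonempty ι) (hr : DirectedIndex r)
    (x : ι → X) (hx : IsCauchyNet d r x) :
    ∃ Y : Set X, DDirected d Y ∧
      (∀ z : X, NetLimEq r (fun l => d (x l) z) (⨆ y ∈ Y, d y z)) ∧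
      (∀ z : X, NetLimEq r (fun l => d z (x l)) (⨅ y ∈ Y, d z y)) := by
  let Y : Set X := {y | ∀ η : ℝ≥0∞, 0 < η → ∃ β, ∀ l, r β l → d y (x l) ≤ η}
  have close : ∀ ε : ℝ≥0∞, 0 < ε →
      ∃ α, ∀ γ, r α γ → ∃ y ∈ Y, d (x γ) y ≤ ε ∧ d y (x γ) ≤ ε := by
    intro ε hε
    obtain ⟨δ, hδ0, hδ⟩ := h2 ε hε
    obtain ⟨α, hα⟩ := exists_close_lower_point hd he hsym hcomp h1 h2 hr hx hδ0
    refine ⟨α, fun γ hγ => ?_⟩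
    obtain ⟨y, hy, hey⟩ := hα γ hγ
    exact ⟨y, hy, hδ _ _ hey, hδ _ _ (by rwa [hsym])⟩
  refine ⟨Y, ?_, fun z => NetLimEq.of_le hr ?_ ?_, fun z => NetLimEq.of_le hr ?_ ?_⟩
  · intro F hF ε hε
    obtain ⟨ε', hε'0, hε'⟩ := exists_between hε
    have hpos : 0 < ε' / 2 := ENNReal.half_pos hε'0.ne'
    obtain ⟨α, hα⟩ := close (ε' / 2) hpos
    have hβ : ∀ z, ∃ β, z ∈ F → ∀ l, r β l → d z (x l) ≤ ε' / 2 := by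
      intro z
      by_cases hz : z ∈ F
      · obtain ⟨β, h⟩ := hF hz (ε' / 2) hpos
        exact ⟨β, fun _ => h⟩
      · exact ⟨α, fun h => absurd h hz⟩
    choose β hβ using hβ
    obtain ⟨γ₀, hγ₀⟩ := hr.exists_forall_finset hne F β
    obtain ⟨γ, h₁, h₂⟩ := hr.2 γ₀ α
    obtain ⟨y, hyY, hy, -⟩ := hα γ h₂
    refine ⟨y, hyY, fun z hz => lt_of_le_of_lt ?_ hε'⟩
    calc d z y ≤ d z (x γ) + d (x γ) y := hd _ _ _
      _ ≤ ε' / 2 + ε' / 2 := add_le_add (hβ z hz γ (hr.1 _ _ _ (hγ₀ z hz) h₁)) hy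
      _ = ε' := ENNReal.add_halves _
  · refine iSup₂_le fun y hy => ENNReal.le_of_forall_pos_le_add fun ε hε _ => ?_
    obtain ⟨β, hβ⟩ := hy ε (by exact_mod_cast hε)
    rw [← tsub_le_iff_right]
    refine le_netLiminf β fun l hl => ?_
    rw [tsub_le_iff_left]
    exact (hd _ (x l) _).trans (add_le_add (hβ l hl) le_rfl)
  · refine ENNReal.le_of_forall_pos_le_add fun ε hε _ => ?_
    obtain ⟨α, hα⟩ := close ε (by exact_mod_cast hε)
    refine netLimsup_le α fun l hl => ?_
    obtain ⟨y, hyY, hy, -⟩ := hα l hl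
    rw [add_comm]
    exact (hd _ y _).trans
      (add_le_add hy (le_iSup₂ (f := fun y (_ : y ∈ Y) => d y z) y hyY))
  · refine ENNReal.le_of_forall_pos_le_add fun ε hε _ => ?_
    obtain ⟨α, hα⟩ := close ε (by exact_mod_cast hε)
    rw [← tsub_le_iff_right]
    refine le_netLiminf α fun l hl => ?_
    rw [tsub_le_iff_right]
    obtain ⟨y, hyY, hy, -⟩ := hα l hl
    exact (iInf₂_le y hyY).trans ((hd _ (x l) _).trans (add_le_add le_rfl hy))
  · refine le_iInf₂ fun y hy => ENNReal.le_of_forall_pos_le_add fun ε hε _ => ?_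
    obtain ⟨β, hβ⟩ := hy ε (by exact_mod_cast hε)
    exact netLimsup_le β fun l hl => (hd _ y _).trans (add_le_add le_rfl (hβ l hl))
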